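/- arXiv:1208.1883 — 12 statements merged into one kernel-verified Lean document; each statement's English description precedes it below -/
import Mathlib

section
/- For every s > 0 there exists r₀ ≥ 1 such that for every real r ≥ r₀ one has inf_{m ∈ ℕ} (2m)^{2 s m} r^{-2m} ≤ exp(−(s/e) (r/8^s)^{1/s}), where the term with m = 0 is interpreted as 1 (convention 0^0 = 1). -/
/-- For every `s > 0` there is `r₀ ≥ 1` such that for all `r ≥ r₀`,
`inf_{m ∈ ℕ} (2m)^{2sm} r^{-2m} ≤ exp(-(s/e) (r/8^s)^{1/s})`,
where `(2m)^{2sm} = exp(2 s m log (2m))` for `m ≥ 1` and the `m = 0` term is `1`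
(convention `0^0 = 1`). -/
theorem iInf_even_le_exp (s : ℝ) (hs : 0 < s) :
    ∃ r₀ : ℝ, 1 ≤ r₀ ∧ ∀ r : ℝ, r₀ ≤ r →
      sInf (Set.range fun m : ℕ =>
          (if m = 0 then (1 : ℝ) else Real.exp (2 * s * m * Real.log (2 * m)))
            * r ^ (-(2 * (m : ℝ))))
        ≤ Real.exp (-(s / Real.exp 1) * (r / (8 : ℝ) ^ s) ^ (1 / s)) := by
  refine ⟨(8 : ℝ) ^ s, Real.one_le_rpow (by norm_num) hs.le, fun r hr => ?_⟩
  have h8 : (0 : ℝ) < 8 ^ s := by positivity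
  have hr0 : 0 < r := h8.trans_le hr
  obtain ⟨R, hR⟩ : ∃ R, R = r ^ (1 / s) := ⟨_, rfl⟩
  have hR0 : 0 < R := hR ▸ Real.rpow_pos_of_pos hr0 _
  have hRr : R ^ s = r := by
    rw [hR, ← Real.rpow_mul hr0.le, one_div_mul_cancel hs.ne', Real.rpow_one]
  have hR8 : 8 ≤ R := by
    rw [← hRr] at hr
    exact (Real.rpow_le_rpow_iff (by norm_num) hR0.le hs).1 hr
  have hlog : Real.log r = s * Real.log R := by rw [← hRr, Real.log_rpow hR0]
  have hexp : (r / (8 : ℝ) ^ s) ^ (1 / s) = R / 8 := by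
    rw [← hRr, ← Real.div_rpow hR0.le (by norm_num), ← Real.rpow_mul (by positivity),
      mul_one_div_cancel hs.ne', Real.rpow_one]
  have he0 : 0 < Real.exp 1 := Real.exp_pos 1
  have he8 : 16 / 7 * Real.exp 1 ≤ 8 := by
    linarith [Real.exp_one_lt_d9]
  have hx : 16 / 7 ≤ R / Real.exp 1 := by
    rw [le_div_iff₀ he0]
    exact he8.trans hR8
  -- The best exponent `2m` is the largest even integer below `R / e`.
  let m : ℕ := ⌊R / Real.exp 1 / 2⌋₊
  have hm_le : (m : ℝ) ≤ R / Real.exp 1 / 2 := Nat.floor_le (by positivity)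
  have hm_lt : R / Real.exp 1 / 2 < m + 1 := Nat.lt_floor_add_one _
  have hm : 0 < (m : ℝ) := by linarith
  have hm0 : m ≠ 0 := fun h => by simp [h] at hm
  have hlogm : Real.log (2 * m) ≤ Real.log R - 1 := by
    rw [← Real.log_exp 1, ← Real.log_div hR0.ne' he0.ne']
    exact Real.log_le_log (by positivity) (by linarith)
  refine le_trans (csInf_le ⟨0, ?_⟩ (Set.mem_range_self m)) ?_
  · rintro _ ⟨k, rfl⟩
    dsimp only
    split_ifs <;> positivity
  · rw [if_neg hm0, hexp, Real.rpow_def_of_pos hr0, ← Real.exp_add, Real.exp_le_exp, hlog]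
    calc 2 * s * m * Real.log (2 * m) + s * Real.log R * -(2 * m)
        = 2 * s * m * (Real.log (2 * m) - Real.log R) := by ring
      _ ≤ 2 * s * m * (-1) := by gcongr; linarith
      _ = s * (-(2 * m)) := by ring
      _ ≤ s * (-(R / Real.exp 1 / 8)) := by gcongr; linarith
      _ = -(s / Real.exp 1) * (R / 8) := by ring
end

section
/- Let 0 < s < ∞ and let f : ℝ → ℂ be smooth and 2π-periodic. Then f is Gevrey–Roumieu of order s if and only if there exist constants B > 0 and K > 0 such that |f̂(m)| ≤ K e^{-B ⟨m⟩^{1/s}} for all m ∈ ℤ. -/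
/-- The `m`-th Fourier coefficient of a `2π`-periodic function `f : ℝ → ℂ`:
`f̂(m) = (1/(2π)) ∫₀^{2π} f x e^{-imx} dx`. -/
noncomputable def fourierCoeffPeriodic (f : ℝ → ℂ) (m : ℤ) : ℂ :=
  (1 / (2 * (Real.pi : ℂ))) *
    ∫ x in (0 : ℝ)..(2 * Real.pi), f x * Complex.exp (-(Complex.I * (m : ℂ) * (x : ℂ)))

theorem Function.Periodic.iteratedDeriv {𝕜 F : Type*} [NontriviallyNormedField 𝕜]
    [NormedAddCommGroup F] [NormedSpace 𝕜 F] {f : 𝕜 → F} {c : 𝕜}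
    (hf : Function.Periodic f c) (k : ℕ) : Function.Periodic (iteratedDeriv k f) c := by
  intro x
  rw [← congrFun (iteratedDeriv_comp_add_const k f c) x]
  congr 1
  exact funext hf

theorem fourierCoeff_lift_eq_fourierCoeffPeriodic {g : ℝ → ℂ}
    (hper : Function.Periodic g (2 * Real.pi)) (m : ℤ) :
    haveI : Fact (0 < 2 * Real.pi) := ⟨Real.two_pi_pos⟩
    fourierCoeff (T := 2 * Real.pi) hper.lift m = fourierCoeffPeriodic g m := by
  have : Fact (0 < 2 * Real.pi) := ⟨Real.two_pi_pos⟩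
  rw [fourierCoeff_eq_intervalIntegral _ m 0, fourierCoeffPeriodic, zero_add, Complex.real_smul]
  push_cast
  congr 1
  refine intervalIntegral.integral_congr fun x _ => ?_
  have hpi : (Real.pi : ℂ) ≠ 0 := by exact_mod_cast Real.pi_ne_zero
  simp only [fourier_coe_apply, Function.Periodic.lift_coe, smul_eq_mul]
  rw [mul_comm]
  congr 2
  push_cast
  field_simp

theorem fourierCoeffPeriodic_deriv {g : ℝ → ℂ} (hg : ContDiff ℝ 1 g)
    (hper : Function.Periodic g (2 * Real.pi)) (m : ℤ) :
    fourierCoeffPeriodic (deriv g) m = Complex.I * m * fourierCoeffPeriodic g m := by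
  have hexp (x : ℝ) : HasDerivAt (fun x : ℝ => Complex.exp (-(Complex.I * (m : ℂ) * (x : ℂ))))
      (Complex.exp (-(Complex.I * (m : ℂ) * (x : ℂ))) * (-(Complex.I * (m : ℂ)))) x := by
    simpa using (((hasDerivAt_id x).ofReal_comp.const_mul (Complex.I * (m : ℂ))).neg).cexp
  have hparts := intervalIntegral.integral_mul_deriv_eq_deriv_mul
    (a := 0) (b := 2 * Real.pi)
    (fun x _ => (hg.differentiable one_ne_zero x).hasDerivAt) (fun x _ => hexp x)
    ((hg.continuous_deriv le_rfl).intervalIntegrable _ _)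
    (Continuous.intervalIntegrable (by fun_prop) _ _)
  have hg0 : g (2 * Real.pi) = g 0 := by simpa using hper 0
  have hexp_end : Complex.exp (-(Complex.I * (m : ℂ) * ((2 * Real.pi : ℝ) : ℂ))) = 1 := by
    rw [Complex.exp_eq_one_iff]
    exact ⟨-m, by push_cast; ring⟩
  simp only [← mul_assoc, intervalIntegral.integral_mul_const, hexp_end, hg0, Complex.ofReal_zero,
    mul_zero, neg_zero, Complex.exp_zero, sub_self, zero_sub] at hparts
  rw [fourierCoeffPeriodic, fourierCoeffPeriodic, ← neg_eq_iff_eq_neg.mpr hparts]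
  ring

theorem fourierCoeffPeriodic_iteratedDeriv {f : ℝ → ℂ} (hf : ContDiff ℝ (⊤ : ℕ∞) f)
    (hper : Function.Periodic f (2 * Real.pi)) (m : ℤ) (k : ℕ) :
    fourierCoeffPeriodic (iteratedDeriv k f) m =
      (Complex.I * m) ^ k * fourierCoeffPeriodic f m := by
  induction k with
  | zero => simp
  | succ k ih =>
    have hk : ContDiff ℝ 1 (iteratedDeriv k f) := by
      rw [iteratedDeriv_eq_iterate]
      exact (hf.iterate_deriv k).of_le (by exact_mod_cast le_top)
    rw [iteratedDeriv_succ, fourierCoeffPeriodic_deriv hk (hper.iteratedDeriv k), ih]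
    ring

theorem norm_fourierCoeffPeriodic_le {g : ℝ → ℂ} {D : ℝ} (hg : ∀ x, ‖g x‖ ≤ D) (m : ℤ) :
    ‖fourierCoeffPeriodic g m‖ ≤ D := by
  have hint := intervalIntegral.norm_integral_le_of_norm_le_const (a := 0) (b := 2 * Real.pi)
    (C := D) (f := fun x : ℝ => g x * Complex.exp (-(Complex.I * (m : ℂ) * (x : ℂ))))
    fun x _ => by
      rw [norm_mul, Complex.norm_exp]
      simpa using hg x
  have hpi := Real.pi_pos
  rw [sub_zero, abs_of_pos (by positivity)] at hint
  rw [fourierCoeffPeriodic, norm_mul]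
  have hnorm : ‖(1 / (2 * (Real.pi : ℂ)))‖ = 1 / (2 * Real.pi) := by
    simp [abs_of_pos hpi]
  rw [hnorm, one_div, inv_mul_le_iff₀ (by positivity)]
  linarith

theorem norm_le_tsum_norm_fourierCoeffPeriodic {g : ℝ → ℂ} (hg : Continuous g)
    (hper : Function.Periodic g (2 * Real.pi))
    (hsum : Summable fun m : ℤ => ‖fourierCoeffPeriodic g m‖) (x : ℝ) :
    ‖g x‖ ≤ ∑' m : ℤ, ‖fourierCoeffPeriodic g m‖ := by
  have : Fact (0 < 2 * Real.pi) := ⟨Real.two_pi_pos⟩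
  let F : C(AddCircle (2 * Real.pi), ℂ) :=
    ⟨hper.lift, continuous_coinduced_dom.mpr hg⟩
  have hF : fourierCoeff F = fourierCoeffPeriodic g :=
    funext fun m => fourierCoeff_lift_eq_fourierCoeffPeriodic hper m
  have hx := has_pointwise_sum_fourier_series_of_summable (f := F)
    (by rw [hF]; exact hsum.of_norm) (x : AddCircle (2 * Real.pi))
  rw [hF] at hx
  change HasSum _ (g x) at hx
  rw [← hx.tsum_eq]
  refine tsum_of_norm_bounded hsum.hasSum fun m => ?_
  rw [norm_smul, fourier_apply, Circle.norm_coe, mul_one]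

/-- For `t ≥ 0`, the power `t ^ (s * k)` is dominated by `exp (b * t)` with a factor of Gevrey growth
in `k`. -/
theorem rpow_mul_exp_neg_le_factorial_rpow {s b t : ℝ} (hs : 0 < s) (hb : 0 < b) (ht : 0 ≤ t)
    (k : ℕ) :
    (t ^ s) ^ k * Real.exp (-(b * t)) ≤ ((s / b) ^ s) ^ k * (k.factorial : ℝ) ^ s := by
  have hfac : (0 : ℝ) < k.factorial := by exact_mod_cast k.factorial_pos
  have hy := Real.pow_div_factorial_le_exp (b * t / s) (by positivity) k
  rw [div_le_iff₀ hfac] at hy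
  have hbase : t ^ k * Real.exp (-(b * t / s)) ≤ (s / b) ^ k * k.factorial := by
    have htk : t ^ k = (s / b) ^ k * (b * t / s) ^ k := by
      rw [← mul_pow]; congr 1; field_simp
    rw [htk, mul_assoc]
    refine mul_le_mul_of_nonneg_left ?_ (by positivity)
    rw [Real.exp_neg, mul_inv_le_iff₀ (Real.exp_pos _)]
    linarith
  have hpow := Real.rpow_le_rpow (by positivity) hbase hs.le
  rw [Real.mul_rpow (by positivity) (by positivity), Real.mul_rpow (by positivity) hfac.le,
    ← Real.exp_mul] at hpow
  have hsb : 0 ≤ s / b := by positivity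
  rw [← Real.rpow_natCast_mul ht, ← Real.rpow_natCast_mul hsb] at hpow
  rw [← Real.rpow_mul_natCast ht, ← Real.rpow_mul_natCast hsb, mul_comm s (k : ℝ)]
  convert! hpow using 3
  field_simp

/-- Optimizing over `k` a bound of the form `(a / r) ^ k * (k!) ^ s` gives decay in
`r ^ (1 / s)`. -/
theorem exists_pow_mul_factorial_rpow_le_exp {s a r : ℝ} (hs : 0 < s) (ha : 0 < a) (hr : 0 < r) :
    ∃ k : ℕ, a ^ k * (k.factorial : ℝ) ^ s / r ^ k ≤
      Real.exp (1 - (r / (Real.exp 1 * a)) ^ (1 / s)) := by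
  set y := (r / (Real.exp 1 * a)) ^ (1 / s) with hy
  have hy0 : 0 ≤ y := by positivity
  have hys : y ^ s = r / (Real.exp 1 * a) := by
    rw [hy, ← Real.rpow_mul (by positivity), one_div_mul_cancel hs.ne', Real.rpow_one]
  refine ⟨⌊y⌋₊, ?_⟩
  set k := ⌊y⌋₊ with hk
  have hfac : (k.factorial : ℝ) ^ s ≤ ((k : ℝ) ^ s) ^ k := by
    rw [← Real.rpow_mul_natCast k.cast_nonneg, mul_comm, Real.rpow_natCast_mul k.cast_nonneg]
    exact Real.rpow_le_rpow (by positivity) (by exact_mod_cast k.factorial_le_pow) hs.le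
  have hks : (k : ℝ) ^ s ≤ r / (Real.exp 1 * a) :=
    hys ▸ Real.rpow_le_rpow k.cast_nonneg (Nat.floor_le hy0) hs.le
  calc a ^ k * (k.factorial : ℝ) ^ s / r ^ k
      ≤ a ^ k * (r / (Real.exp 1 * a)) ^ k / r ^ k := by
        gcongr
        exact hfac.trans (by gcongr)
    _ = Real.exp (-k) := by
        rw [← mul_pow, ← div_pow, Real.exp_neg, ← Real.exp_one_pow, ← inv_pow]
        congr 1
        field_simp
    _ ≤ Real.exp (1 - y) := by
        refine Real.exp_le_exp.mpr ?_
        linarith [Nat.lt_floor_add_one y]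

theorem summable_exp_neg_mul_japaneseBracket_rpow {s b : ℝ} (hs : 0 < s) (hb : 0 < b) :
    Summable fun m : ℤ => Real.exp (-(b * Real.sqrt (1 + (m : ℝ) ^ 2) ^ (1 / s))) := by
  have hsq : Summable fun m : ℤ => ((s / b) ^ s) ^ 2 * ((2).factorial : ℝ) ^ s *
      (1 / (m : ℝ) ^ 2) := (Real.summable_one_div_int_pow.mpr one_lt_two).mul_left _
  refine hsq.of_norm_bounded_eventually ?_
  filter_upwards [(Set.finite_singleton (0 : ℤ)).compl_mem_cofinite] with m hm
  have hm0 : (m : ℝ) ≠ 0 := by exact_mod_cast hm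
  have hbound := rpow_mul_exp_neg_le_factorial_rpow hs hb
    (t := Real.sqrt (1 + (m : ℝ) ^ 2) ^ (1 / s)) (by positivity) 2
  rw [← Real.rpow_mul (Real.sqrt_nonneg _), one_div_mul_cancel hs.ne', Real.rpow_one,
    Real.sq_sqrt (by positivity)] at hbound
  rw [Real.norm_of_nonneg (Real.exp_pos _).le, mul_one_div, le_div_iff₀ (by positivity)]
  refine le_trans ?_ hbound
  rw [mul_comm]
  gcongr
  linarith

theorem fourierCoeffPeriodic_decay_of_gevrey {s A C : ℝ} (hs : 0 < s) (hA : 0 < A) (hC : 0 < C)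
    {f : ℝ → ℂ} (hf : ContDiff ℝ (⊤ : ℕ∞) f) (hper : Function.Periodic f (2 * Real.pi))
    (hbound : ∀ k : ℕ, ∀ x : ℝ, ‖iteratedDeriv k f x‖ ≤ C * A ^ k * (k.factorial : ℝ) ^ s) :
    ∃ B > (0 : ℝ), ∃ K > (0 : ℝ), ∀ m : ℤ,
      ‖fourierCoeffPeriodic f m‖ ≤
        K * Real.exp (-B * Real.sqrt (1 + (m : ℝ) ^ 2) ^ (1 / s)) := by
  have hcoeff (m : ℤ) (k : ℕ) :
      |(m : ℝ)| ^ k * ‖fourierCoeffPeriodic f m‖ ≤ C * A ^ k * (k.factorial : ℝ) ^ s := by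
    simpa [fourierCoeffPeriodic_iteratedDeriv hf hper] using
      norm_fourierCoeffPeriodic_le (hbound k) m
  set B := (1 / (2 * (Real.exp 1 * A))) ^ (1 / s) with hB
  have hB0 : 0 < B := by positivity
  refine ⟨B, hB0, C * Real.exp (1 + B), by positivity, fun m => ?_⟩
  rw [mul_assoc, ← Real.exp_add]
  rcases eq_or_ne m 0 with rfl | hm
  · have h0 := hcoeff 0 0
    simp only [pow_zero, one_mul, mul_one, Nat.factorial_zero, Nat.cast_one, Real.one_rpow] at h0
    refine h0.trans (le_mul_of_one_le_right hC.le (Real.one_le_exp ?_))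
    simp
  · have hmabs : (1 : ℝ) ≤ |(m : ℝ)| := by exact_mod_cast Int.one_le_abs hm
    obtain ⟨k, hk⟩ := exists_pow_mul_factorial_rpow_le_exp hs hA (zero_lt_one.trans_le hmabs)
    have hbracket : Real.sqrt (1 + (m : ℝ) ^ 2) ≤ 2 * |(m : ℝ)| := by
      refine Real.sqrt_le_iff.mpr ⟨by positivity, ?_⟩
      rw [← sq_abs (m : ℝ)]
      nlinarith
    have hBm : B * Real.sqrt (1 + (m : ℝ) ^ 2) ^ (1 / s) ≤
        (|(m : ℝ)| / (Real.exp 1 * A)) ^ (1 / s) := by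
      rw [hB, ← Real.mul_rpow (by positivity) (by positivity)]
      refine Real.rpow_le_rpow (by positivity) ?_ (by positivity)
      rw [one_div, inv_mul_le_iff₀ (by positivity)]
      convert! hbracket using 1
      field_simp
    calc ‖fourierCoeffPeriodic f m‖
        ≤ C * A ^ k * (k.factorial : ℝ) ^ s / |(m : ℝ)| ^ k := by
          rw [le_div_iff₀ (by positivity), mul_comm]
          exact hcoeff m k
      _ = C * (A ^ k * (k.factorial : ℝ) ^ s / |(m : ℝ)| ^ k) := by ring
      _ ≤ C * Real.exp (1 - (|(m : ℝ)| / (Real.exp 1 * A)) ^ (1 / s)) := by gcongr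
      _ ≤ _ := by
          gcongr
          linarith

theorem gevrey_of_fourierCoeffPeriodic_decay {s B K : ℝ} (hs : 0 < s) (hB : 0 < B) (hK : 0 < K)
    {f : ℝ → ℂ} (hf : ContDiff ℝ (⊤ : ℕ∞) f) (hper : Function.Periodic f (2 * Real.pi))
    (hdecay : ∀ m : ℤ, ‖fourierCoeffPeriodic f m‖ ≤
      K * Real.exp (-B * Real.sqrt (1 + (m : ℝ) ^ 2) ^ (1 / s))) :
    ∃ A > (0 : ℝ), ∃ C > (0 : ℝ), ∀ k : ℕ, ∀ x : ℝ,
      ‖iteratedDeriv k f x‖ ≤ C * A ^ k * (k.factorial : ℝ) ^ s := by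
  have hb : 0 < B / 2 := by positivity
  have hsum := summable_exp_neg_mul_japaneseBracket_rpow hs hb
  set S := ∑' m : ℤ, Real.exp (-(B / 2 * Real.sqrt (1 + (m : ℝ) ^ 2) ^ (1 / s)))
  have hS : 0 < S := hsum.tsum_pos (fun _ => (Real.exp_pos _).le) 0 (Real.exp_pos _)
  refine ⟨(s / (B / 2)) ^ s, by positivity, K * S, by positivity, fun k x => ?_⟩
  set M := ((s / (B / 2)) ^ s) ^ k * (k.factorial : ℝ) ^ s with hM
  have hterm (m : ℤ) : ‖fourierCoeffPeriodic (iteratedDeriv k f) m‖ ≤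
      K * M * Real.exp (-(B / 2 * Real.sqrt (1 + (m : ℝ) ^ 2) ^ (1 / s))) := by
    set t := Real.sqrt (1 + (m : ℝ) ^ 2) ^ (1 / s) with ht
    have hts : t ^ s = Real.sqrt (1 + (m : ℝ) ^ 2) := by
      rw [ht, ← Real.rpow_mul (Real.sqrt_nonneg _), one_div_mul_cancel hs.ne', Real.rpow_one]
    have hbound := rpow_mul_exp_neg_le_factorial_rpow hs hb (t := t) (by positivity) k
    have hmt : |(m : ℝ)| ≤ t ^ s := hts ▸ Real.abs_le_sqrt (by linarith)
    calc ‖fourierCoeffPeriodic (iteratedDeriv k f) m‖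
        = |(m : ℝ)| ^ k * ‖fourierCoeffPeriodic f m‖ := by
          simp [fourierCoeffPeriodic_iteratedDeriv hf hper]
      _ ≤ (t ^ s) ^ k * (K * Real.exp (-B * t)) := by
          gcongr
          exact hdecay m
      _ = K * ((t ^ s) ^ k * Real.exp (-(B / 2 * t))) * Real.exp (-(B / 2 * t)) := by
          rw [show -B * t = -(B / 2 * t) + -(B / 2 * t) by ring, Real.exp_add]
          ring
      _ ≤ K * M * Real.exp (-(B / 2 * t)) := by gcongr
  have hmajorant := hsum.mul_left (K * M)
  have hsummable := hmajorant.of_nonneg_of_le (fun _ => norm_nonneg _) hterm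
  have hcont : Continuous (iteratedDeriv k f) :=
    hf.continuous_iteratedDeriv k (by exact_mod_cast le_top)
  calc ‖iteratedDeriv k f x‖
      ≤ ∑' m : ℤ, ‖fourierCoeffPeriodic (iteratedDeriv k f) m‖ :=
        norm_le_tsum_norm_fourierCoeffPeriodic hcont (hper.iteratedDeriv k) hsummable x
    _ ≤ ∑' m : ℤ, K * M * Real.exp (-(B / 2 * Real.sqrt (1 + (m : ℝ) ^ 2) ^ (1 / s))) :=
        hsummable.tsum_le_tsum hterm hmajorant
    _ = K * S * ((s / (B / 2)) ^ s) ^ k * (k.factorial : ℝ) ^ s := by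
        rw [tsum_mul_left, hM]
        ring

/-- A smooth `2π`-periodic function `f : ℝ → ℂ` is Gevrey–Roumieu of order `s` if and only
if there exist `B > 0` and `K > 0` with `|f̂(m)| ≤ K e^{-B ⟨m⟩^{1/s}}` for all `m ∈ ℤ`,
where `⟨m⟩ = (1 + m²)^{1/2}`. -/
theorem gevreyRoumieu_iff_fourier_decay (s : ℝ) (hs : 0 < s)
    (f : ℝ → ℂ) (hf : ContDiff ℝ (⊤ : ℕ∞) f) (hper : ∀ x : ℝ, f (x + 2 * Real.pi) = f x) :
    (∃ A > (0 : ℝ), ∃ C > (0 : ℝ), ∀ k : ℕ, ∀ x : ℝ,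
        ‖iteratedDeriv k f x‖ ≤ C * A ^ k * ((Nat.factorial k : ℝ)) ^ s)
      ↔ (∃ B > (0 : ℝ), ∃ K > (0 : ℝ), ∀ m : ℤ,
        ‖fourierCoeffPeriodic f m‖
          ≤ K * Real.exp (-B * (Real.sqrt (1 + (m : ℝ) ^ 2)) ^ (1 / s))) := by
  constructor
  · rintro ⟨A, hA, C, hC, hbound⟩
    exact fourierCoeffPeriodic_decay_of_gevrey hs hA hC hf hper hbound
  · rintro ⟨B, hB, K, hK, hdecay⟩
    exact gevrey_of_fourierCoeffPeriodic_decay hs hB hK hf hper hdecay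
end

section
/- Let 0 < s < ∞ and let f : ℝ → ℂ be smooth and 2π-periodic. Then f is Gevrey–Roumieu of order s if and only if there exist constants A > 0 and C > 0 such that sup_{x∈ℝ} |f^{(2k)}(x)| ≤ C A^{2k} ((2k)!)^s for all k ∈ ℕ (i.e. the Gevrey bounds for all derivatives are equivalent to the corresponding bounds for even-order derivatives only). -/
/-- Landau-type inequality: a bound on a function and on its second derivative bounds the
first derivative. -/
theorem norm_deriv_le_of_norm_le_of_norm_deriv_deriv_le {E : Type*} [NormedAddCommGroup E]
    [NormedSpace ℝ E] {g g' g'' : ℝ → E} {M N : ℝ}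
    (hg : ∀ x, HasDerivAt g (g' x) x) (hg' : ∀ x, HasDerivAt g' (g'' x) x)
    (hM : ∀ x, ‖g x‖ ≤ M) (hN : ∀ x, ‖g'' x‖ ≤ N) (x : ℝ) :
    ‖g' x‖ ≤ 2 * M + N := by
  have hN0 : 0 ≤ N := (norm_nonneg _).trans (hN x)
  have hlip : ∀ t ∈ Set.Icc x (x + 1), ‖g' t - g' x‖ ≤ N := by
    intro t ht
    have h := convex_univ.norm_image_sub_le_of_norm_hasDerivWithin_le
      (fun y _ => (hg' y).hasDerivWithinAt) (fun y _ => hN y)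
      (Set.mem_univ x) (Set.mem_univ t)
    refine h.trans (mul_le_of_le_one_right hN0 ?_)
    rw [Real.norm_eq_abs, abs_le]
    constructor <;> linarith [ht.1, ht.2]
  have hh : ∀ t, HasDerivAt (fun t => g t - t • g' x) (g' t - g' x) t := by
    intro t
    simpa using (hg t).fun_sub ((hasDerivAt_id t).smul_const (g' x))
  have h := (convex_Icc x (x + 1)).norm_image_sub_le_of_norm_hasDerivWithin_le
    (fun y _ => (hh y).hasDerivWithinAt) hlip
    (Set.left_mem_Icc.2 (by linarith)) (Set.right_mem_Icc.2 (by linarith))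
  have heq : g' x = g (x + 1) - g x -
      ((g (x + 1) - (x + 1) • g' x) - (g x - x • g' x)) := by
    rw [add_smul, one_smul]; abel
  rw [add_sub_cancel_left, norm_one, mul_one] at h
  calc ‖g' x‖ ≤ ‖g (x + 1) - g x‖ + ‖(g (x + 1) - (x + 1) • g' x) - (g x - x • g' x)‖ := by
        conv_lhs => rw [heq]
        exact norm_sub_le _ _
    _ ≤ (‖g (x + 1)‖ + ‖g x‖) + N := add_le_add (norm_sub_le _ _) h
    _ ≤ 2 * M + N := by linarith [hM x, hM (x + 1)]

theorem ContDiff.hasDerivAt_iteratedDeriv {E : Type*} [NormedAddCommGroup E] [NormedSpace ℝ E]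
    {f : ℝ → E} (hf : ContDiff ℝ (⊤ : ℕ∞) f) (n : ℕ) (x : ℝ) :
    HasDerivAt (iteratedDeriv n f) (iteratedDeriv (n + 1) f x) x := by
  rw [iteratedDeriv_succ]
  exact (hf.differentiable_iteratedDeriv n (by exact_mod_cast WithTop.coe_lt_top n) x).hasDerivAt

theorem factorial_succ_rpow_le {s : ℝ} (hs : 0 ≤ s) (n : ℕ) :
    ((n + 1).factorial : ℝ) ^ s ≤ ((2 : ℝ) ^ s) ^ n * (n.factorial : ℝ) ^ s := by
  have h : ((n + 1 : ℕ) : ℝ) ≤ 2 ^ n := by exact_mod_cast Nat.lt_two_pow_self (n := n)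
  rw [Nat.factorial_succ, Nat.cast_mul, Real.mul_rpow (by positivity) (by positivity),
    Real.rpow_pow_comm (by norm_num)]
  gcongr


/-- A smooth `2π`-periodic function `f : ℝ → ℂ` is Gevrey–Roumieu of order `s`
(i.e. `sup_x |f^{(k)}(x)| ≤ C A^k (k!)^s` for all `k`) if and only if the corresponding
bounds hold for the even-order derivatives only:
`sup_x |f^{(2k)}(x)| ≤ C A^{2k} ((2k)!)^s` for all `k`. -/
theorem gevreyRoumieu_iff_even_derivatives (s : ℝ) (hs : 0 < s)
    (f : ℝ → ℂ) (hf : ContDiff ℝ (⊤ : ℕ∞) f) (hper : ∀ x : ℝ, f (x + 2 * Real.pi) = f x) :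
    (∃ A > (0 : ℝ), ∃ C > (0 : ℝ), ∀ k : ℕ, ∀ x : ℝ,
        ‖iteratedDeriv k f x‖ ≤ C * A ^ k * ((Nat.factorial k : ℝ)) ^ s)
      ↔ (∃ A > (0 : ℝ), ∃ C > (0 : ℝ), ∀ k : ℕ, ∀ x : ℝ,
        ‖iteratedDeriv (2 * k) f x‖ ≤ C * A ^ (2 * k) * ((Nat.factorial (2 * k) : ℝ)) ^ s) := by
  constructor
  · rintro ⟨A, hA, C, hC, h⟩
    exact ⟨A, hA, C, hC, fun k x => h (2 * k) x⟩
  rintro ⟨A, hA, C, hC, h⟩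
  obtain ⟨B, hAB, hB⟩ : ∃ B : ℝ, A ≤ B ∧ 1 ≤ B := ⟨max A 1, le_max_left _ _, le_max_right _ _⟩
  have hB0 : 0 < B := by linarith
  have h2s : (1 : ℝ) ≤ 2 ^ s := Real.one_le_rpow (by norm_num) hs.le
  have hbound : ∀ k x, ‖iteratedDeriv (2 * k) f x‖ ≤
      C * B ^ (2 * k) * ((2 * k).factorial : ℝ) ^ s := fun k x =>
    (h k x).trans (by gcongr)
  refine ⟨B * 2 ^ s, by positivity, 3 * C * B, by positivity, fun n x => ?_⟩
  obtain ⟨k, rfl | rfl⟩ := n.even_or_odd'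
  · refine (hbound k x).trans ?_
    have h1 : C ≤ 3 * C * B := by nlinarith
    have h2 : B ≤ B * 2 ^ s := le_mul_of_one_le_right hB0.le h2s
    gcongr
  · have hL := norm_deriv_le_of_norm_le_of_norm_deriv_deriv_le
      (hf.hasDerivAt_iteratedDeriv (2 * k)) (hf.hasDerivAt_iteratedDeriv (2 * k + 1))
      (hbound k) (hbound (k + 1)) x
    have hmono : C * B ^ (2 * k) * ((2 * k).factorial : ℝ) ^ s ≤
        C * B ^ (2 * (k + 1)) * ((2 * (k + 1)).factorial : ℝ) ^ s := by
      gcongr <;> first | exact hB | omega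
    calc ‖iteratedDeriv (2 * k + 1) f x‖
        ≤ 3 * C * B ^ (2 * k + 1 + 1) * ((2 * k + 1 + 1).factorial : ℝ) ^ s := by
          rw [show 2 * (k + 1) = 2 * k + 1 + 1 by ring] at hL hmono
          linarith
      _ ≤ 3 * C * B ^ (2 * k + 1 + 1) *
          (((2 : ℝ) ^ s) ^ (2 * k + 1) * ((2 * k + 1).factorial : ℝ) ^ s) := by
          gcongr
          exact factorial_succ_rpow_le hs.le _
      _ = 3 * C * B * (B * 2 ^ s) ^ (2 * k + 1) * ((2 * k + 1).factorial : ℝ) ^ s := by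
          rw [mul_pow]; ring
end

section
/- Let 0 < s < ∞ and let f : ℝ → ℂ be smooth and 2π-periodic. Then f is Gevrey–Beurling of order s if and only if for every A > 0 there exists C_A > 0 such that sup_{x∈ℝ} |f^{(2k)}(x)| ≤ C_A A^{2k} ((2k)!)^s for all k ∈ ℕ. -/
/-- Landau-type inequality: bounds on `g` and on its second derivative bound its first
derivative. -/
theorem norm_deriv_mul_le_of_norm_le {E : Type*} [NormedAddCommGroup E] [NormedSpace ℝ E]
    {g g' g'' : ℝ → E} (hg : ∀ x, HasDerivAt g (g' x) x) (hg' : ∀ x, HasDerivAt g' (g'' x) x)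
    {a b h : ℝ} (hh : 0 ≤ h) (ha : ∀ x, ‖g x‖ ≤ a) (hb : ∀ x, ‖g'' x‖ ≤ b) (x : ℝ) :
    ‖g' x‖ * h ≤ 2 * a + b * h ^ 2 := by
  have hb0 : 0 ≤ b := (norm_nonneg _).trans (hb x)
  have hlip (t : ℝ) (ht : t ∈ Set.Ico x (x + h)) : ‖g' t - g' x‖ ≤ b * h := by
    have := norm_image_sub_le_of_norm_deriv_le_segment' (a := x) (b := t)
      (fun y _ => (hg' y).hasDerivWithinAt) (fun y _ => hb y) t ⟨ht.1, le_rfl⟩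
    exact this.trans (mul_le_mul_of_nonneg_left (by linarith [ht.2]) hb0)
  have hder (t : ℝ) : HasDerivAt (fun y => g y - (y - x) • g' x) (g' t - g' x) t := by
    simpa using (hg t).fun_sub (((hasDerivAt_id t).sub_const x).smul_const (g' x))
  have hmv := norm_image_sub_le_of_norm_deriv_le_segment'
    (fun y _ => (hder y).hasDerivWithinAt) hlip (x + h) ⟨by linarith, le_rfl⟩
  simp only [add_sub_cancel_left, sub_self, zero_smul, sub_zero] at hmv
  calc ‖g' x‖ * h = ‖h • g' x‖ := by rw [norm_smul, Real.norm_of_nonneg hh, mul_comm]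
    _ ≤ (‖g (x + h)‖ + ‖g x‖) + ‖g (x + h) - h • g' x - g x‖ := by
      calc ‖h • g' x‖ = ‖(g (x + h) - g x) - (g (x + h) - h • g' x - g x)‖ := by congr 1; abel
        _ ≤ _ := (norm_sub_le _ _).trans (add_le_add_left (norm_sub_le _ _) _)
    _ ≤ 2 * a + b * h ^ 2 := by nlinarith [ha (x + h), ha x]

/-- A smooth `2π`-periodic function `f : ℝ → ℂ` is Gevrey–Beurling of order `s`
(i.e. for every `A > 0` there is `C_A > 0` with `sup_x |f^{(k)}(x)| ≤ C_A A^k (k!)^s` for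
all `k`) if and only if the corresponding bounds hold for the even-order derivatives only:
for every `A > 0` there is `C_A > 0` with `sup_x |f^{(2k)}(x)| ≤ C_A A^{2k} ((2k)!)^s`
for all `k`. -/
theorem gevreyBeurling_iff_even_derivatives (s : ℝ) (hs : 0 < s)
    (f : ℝ → ℂ) (hf : ContDiff ℝ (⊤ : ℕ∞) f) (hper : ∀ x : ℝ, f (x + 2 * Real.pi) = f x) :
    (∀ A > (0 : ℝ), ∃ C > (0 : ℝ), ∀ k : ℕ, ∀ x : ℝ,
        ‖iteratedDeriv k f x‖ ≤ C * A ^ k * ((Nat.factorial k : ℝ)) ^ s)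
      ↔ (∀ A > (0 : ℝ), ∃ C > (0 : ℝ), ∀ k : ℕ, ∀ x : ℝ,
        ‖iteratedDeriv (2 * k) f x‖ ≤ C * A ^ (2 * k) * ((Nat.factorial (2 * k) : ℝ)) ^ s) := by
  have hD (n : ℕ) (x : ℝ) : HasDerivAt (iteratedDeriv n f) (iteratedDeriv (n + 1) f x) x := by
    rw [iteratedDeriv_succ]
    exact (hf.differentiable_iteratedDeriv n (by exact_mod_cast WithTop.coe_lt_top n) x).hasDerivAt
  refine ⟨fun H A hA => (H A hA).imp fun C hC => ⟨hC.1, fun k => hC.2 (2 * k)⟩, fun H A hA => ?_⟩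
  obtain ⟨C, hC, hbound⟩ := H A hA
  have h2s : (0 : ℝ) < 2 ^ s := by positivity
  refine ⟨C * (2 + 2 ^ s), by positivity, fun n x => ?_⟩
  obtain ⟨k, rfl | rfl⟩ := n.even_or_odd'
  · refine (hbound k x).trans ?_
    gcongr
    nlinarith
  · set p : ℝ := ((2 * k + 1 : ℕ) : ℝ) ^ s with hp
    set F : ℝ := ((2 * k).factorial : ℝ) ^ s with hF
    have hp0 : 0 < p := by positivity
    have hF0 : 0 < F := by positivity
    have hfac1 : ((2 * k + 1).factorial : ℝ) ^ s = p * F := by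
      rw [Nat.factorial_succ, Nat.cast_mul, Real.mul_rpow (by positivity) (by positivity)]
    have hfac2 : ((2 * (k + 1)).factorial : ℝ) ^ s ≤ 2 ^ s * p * (p * F) := by
      rw [← hfac1, hp, ← Real.mul_rpow (by positivity) (by positivity),
        ← Real.mul_rpow (by positivity) (by positivity)]
      refine Real.rpow_le_rpow (by positivity) ?_ hs.le
      rw [show 2 * (k + 1) = 2 * k + 1 + 1 by ring, Nat.factorial_succ (2 * k + 1), Nat.cast_mul]
      gcongr
      push_cast
      linarith [(k.cast_nonneg : (0 : ℝ) ≤ k)]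
    have hb (y : ℝ) : ‖iteratedDeriv (2 * k + 1 + 1) f y‖
        ≤ C * A ^ (2 * (k + 1)) * (2 ^ s * p * (p * F)) :=
      (hbound (k + 1) y).trans (by gcongr)
    have key := norm_deriv_mul_le_of_norm_le (hD (2 * k)) (hD (2 * k + 1))
      (h := (A * p)⁻¹) (by positivity) (hbound k) hb x
    rw [← div_eq_mul_inv, div_le_iff₀ (by positivity)] at key
    refine key.trans_eq ?_
    rw [hfac1]
    field_simp
    ring
end

section
/- Let 0 < s < ∞ and let f : ℝ → ℂ be smooth and 2π-periodic. Then f is Gevrey–Roumieu of order s if and only if there exist constants A > 0 and C > 0 such that (∫₀^{2π} |f^{(k)}(x)|² dx)^{1/2} ≤ C A^k (k!)^s for all k ∈ ℕ (i.e. the sup-norm Gevrey bounds are equivalent to the L²-norm Gevrey bounds). -/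
/-- On `[0, 2π]`, the `L¹` norm is at most four times any positive bound for the `L²` norm. -/
lemma integral_norm_le_of_sqrt_integral_norm_sq_le {h : ℝ → ℂ} (hc : Continuous h) {M : ℝ}
    (hM : 0 < M)
    (hL : Real.sqrt (∫ x in (0 : ℝ)..(2 * Real.pi), ‖h x‖ ^ 2) ≤ M) :
    ∫ x in (0 : ℝ)..(2 * Real.pi), ‖h x‖ ≤ 4 * M := by
  have hsq : ∫ x in (0 : ℝ)..(2 * Real.pi), ‖h x‖ ^ 2 ≤ M ^ 2 := (Real.sqrt_le_left hM.le).1 hL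
  have hmono : ∫ x in (0 : ℝ)..(2 * Real.pi), ‖h x‖ ≤
      ∫ x in (0 : ℝ)..(2 * Real.pi), (M / 2 + (2 * M)⁻¹ * ‖h x‖ ^ 2) := by
    refine intervalIntegral.integral_mono_on Real.two_pi_pos.le
      (hc.norm.intervalIntegrable _ _)
      ((by fun_prop : Continuous fun x => M / 2 + (2 * M)⁻¹ * ‖h x‖ ^ 2).intervalIntegrable _ _)
      fun x _ => ?_
    have hdiff : M / 2 + (2 * M)⁻¹ * ‖h x‖ ^ 2 - ‖h x‖ = (2 * M)⁻¹ * (M - ‖h x‖) ^ 2 := by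
      field_simp
      ring
    have : 0 ≤ (2 * M)⁻¹ * (M - ‖h x‖) ^ 2 := by positivity
    linarith
  rw [intervalIntegral.integral_add intervalIntegrable_const
    ((by fun_prop : Continuous fun x => (2 * M)⁻¹ * ‖h x‖ ^ 2).intervalIntegrable _ _),
    intervalIntegral.integral_const_mul, intervalIntegral.integral_const, smul_eq_mul] at hmono
  have hscaled : (2 * M)⁻¹ * ∫ x in (0 : ℝ)..(2 * Real.pi), ‖h x‖ ^ 2 ≤ (2 * M)⁻¹ * M ^ 2 := by
    gcongr
  have hcancel : (2 * M)⁻¹ * M ^ 2 = M / 2 := by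
    field_simp
  nlinarith [Real.pi_lt_d2]

/-- A Sobolev inequality on the circle: the sup norm of a `2π`-periodic `C¹` function is controlled
by `L²` bounds of the function and its derivative. -/
lemma Function.Periodic.norm_le_of_sqrt_integral_norm_sq_le {g : ℝ → ℂ}
    (hper : Function.Periodic g (2 * Real.pi)) (hg : ContDiff ℝ 1 g) {M N : ℝ}
    (hM : 0 < M) (hN : 0 < N)
    (hgM : Real.sqrt (∫ x in (0 : ℝ)..(2 * Real.pi), ‖g x‖ ^ 2) ≤ M)
    (hgN : Real.sqrt (∫ x in (0 : ℝ)..(2 * Real.pi), ‖deriv g x‖ ^ 2) ≤ N) (x : ℝ) :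
    ‖g x‖ ≤ 4 * M + 4 * N := by
  have hπ := Real.two_pi_pos
  obtain ⟨x₀, hx₀, hx⟩ := hper.exists_mem_Ico₀ hπ x
  rw [hx]
  have hdc : Continuous (deriv g) := hg.continuous_deriv le_rfl
  have hg1 := integral_norm_le_of_sqrt_integral_norm_sq_le hg.continuous hM hgM
  have hg2 := integral_norm_le_of_sqrt_integral_norm_sq_le hdc hN hgN
  have hpt : ∀ y ∈ Set.Icc 0 (2 * Real.pi), ‖g x₀‖ ≤ ‖g y‖ + 4 * N := by
    intro y hy
    have hftc : ∫ t in y..x₀, deriv g t = g x₀ - g y :=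
      intervalIntegral.integral_deriv_eq_sub (fun t _ => (hg.differentiable one_ne_zero) t)
        (hdc.intervalIntegrable _ _)
    have hle : ‖∫ t in y..x₀, deriv g t‖ ≤ ∫ t in (0 : ℝ)..(2 * Real.pi), ‖deriv g t‖ := by
      refine intervalIntegral.norm_integral_le_integral_norm_uIoc.trans ?_
      rw [intervalIntegral.integral_of_le hπ.le]
      refine MeasureTheory.setIntegral_mono_set
        ((intervalIntegrable_iff_integrableOn_Ioc_of_le hπ.le).1
          (hdc.norm.intervalIntegrable _ _))
        (Filter.Eventually.of_forall fun t => norm_nonneg _)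
        (Set.Ioc_subset_Ioc (le_min hy.1 hx₀.1) (max_le hy.2 hx₀.2.le)).eventuallyLE
    rw [hftc] at hle
    have := norm_sub_norm_le (g x₀) (g y)
    linarith
  have hint := intervalIntegral.integral_mono_on (μ := MeasureTheory.volume) hπ.le
    intervalIntegrable_const
    ((by fun_prop : Continuous fun y => ‖g y‖ + 4 * N).intervalIntegrable _ _) hpt
  rw [intervalIntegral.integral_add (hg.continuous.norm.intervalIntegrable _ _)
    intervalIntegrable_const,
    intervalIntegral.integral_const, intervalIntegral.integral_const, smul_eq_mul,
    smul_eq_mul] at hint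
  have h1 : (2 * Real.pi) * ‖g x₀‖ ≤ (2 * Real.pi) * (4 * M + 4 * N) := by
    nlinarith [Real.pi_gt_three]
  exact le_of_mul_le_mul_left h1 hπ

/-- A smooth `2π`-periodic function `f : ℝ → ℂ` is Gevrey–Roumieu of order `s`
(sup-norm bounds `sup_x |f^{(k)}(x)| ≤ C A^k (k!)^s`) if and only if the corresponding
`L²`-norm bounds hold: `(∫₀^{2π} |f^{(k)}(x)|² dx)^{1/2} ≤ C A^k (k!)^s` for all `k`. -/
theorem gevreyRoumieu_iff_L2_bounds (s : ℝ) (hs : 0 < s)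
    (f : ℝ → ℂ) (hf : ContDiff ℝ (⊤ : ℕ∞) f) (hper : ∀ x : ℝ, f (x + 2 * Real.pi) = f x) :
    (∃ A > (0 : ℝ), ∃ C > (0 : ℝ), ∀ k : ℕ, ∀ x : ℝ,
        ‖iteratedDeriv k f x‖ ≤ C * A ^ k * ((Nat.factorial k : ℝ)) ^ s)
      ↔ (∃ A > (0 : ℝ), ∃ C > (0 : ℝ), ∀ k : ℕ,
        Real.sqrt (∫ x in (0 : ℝ)..(2 * Real.pi), ‖iteratedDeriv k f x‖ ^ 2)
          ≤ C * A ^ k * ((Nat.factorial k : ℝ)) ^ s) := by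
  have hsmooth : ∀ k : ℕ, ContDiff ℝ 1 (iteratedDeriv k f) := fun k => by
    rw [iteratedDeriv_eq_iterate]
    exact (hf.iterate_deriv k).of_le (by exact_mod_cast le_top)
  constructor
  · rintro ⟨A, hA, C, hC, h⟩
    refine ⟨A, hA, 3 * C, by positivity, fun k => ?_⟩
    set M := C * A ^ k * ((Nat.factorial k : ℝ)) ^ s with hM
    have hM0 : 0 ≤ M := by positivity
    have hint : ∫ x in (0 : ℝ)..(2 * Real.pi), ‖iteratedDeriv k f x‖ ^ 2 ≤
        ∫ x in (0 : ℝ)..(2 * Real.pi), M ^ 2 :=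
      intervalIntegral.integral_mono_on Real.two_pi_pos.le
        (((hsmooth k).continuous.norm.pow 2).intervalIntegrable _ _) (by simp)
        fun x _ => pow_le_pow_left₀ (norm_nonneg _) (h k x) 2
    rw [intervalIntegral.integral_const, smul_eq_mul] at hint
    rw [show 3 * C * A ^ k * ((Nat.factorial k : ℝ)) ^ s = 3 * M by rw [hM]; ring]
    refine (Real.sqrt_le_left (by positivity)).2 ?_
    nlinarith [Real.pi_lt_d2, sq_nonneg M]
  · rintro ⟨A, hA, C, hC, h⟩
    refine ⟨A * 2 ^ s, by positivity, 4 * C * (1 + A), by positivity, fun k x => ?_⟩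
    have hperk : Function.Periodic (iteratedDeriv k f) (2 * Real.pi) := fun y => by
      rw [← congrFun (iteratedDeriv_comp_add_const k f (2 * Real.pi)) y, funext hper]
    have hk := hperk.norm_le_of_sqrt_integral_norm_sq_le (hsmooth k) (by positivity)
      (by positivity) (h k) (iteratedDeriv_succ (n := k) (f := f) ▸ h (k + 1)) x
    have hfac : ((Nat.factorial (k + 1) : ℝ)) ^ s =
        ((k : ℝ) + 1) ^ s * ((Nat.factorial k : ℝ)) ^ s := by
      rw [Nat.factorial_succ, Nat.cast_mul, Real.mul_rpow (by positivity) (by positivity)]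
      push_cast
      rfl
    have hpow : ((k : ℝ) + 1) ^ s ≤ ((2 : ℝ) ^ s) ^ k := by
      rw [← Real.rpow_natCast, ← Real.rpow_mul zero_le_two, mul_comm s,
        Real.rpow_mul zero_le_two, Real.rpow_natCast]
      refine Real.rpow_le_rpow (by positivity) ?_ hs.le
      exact_mod_cast Nat.lt_two_pow_self (n := k)
    have hone : (1 : ℝ) ≤ ((2 : ℝ) ^ s) ^ k :=
      one_le_pow₀ (Real.one_le_rpow one_le_two hs.le)
    rw [hfac] at hk
    calc ‖iteratedDeriv k f x‖
        ≤ 4 * (C * A ^ k * (Nat.factorial k : ℝ) ^ s) * (1 + A * ((k : ℝ) + 1) ^ s) := by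
          refine hk.trans_eq ?_
          ring
      _ ≤ 4 * (C * A ^ k * (Nat.factorial k : ℝ) ^ s) *
          (((2 : ℝ) ^ s) ^ k + A * ((2 : ℝ) ^ s) ^ k) := by
          gcongr
      _ = 4 * C * (1 + A) * (A * 2 ^ s) ^ k * (Nat.factorial k : ℝ) ^ s := by
          rw [mul_pow]
          ring
end

section
/- Let I be a countable index set, s > 0, and w : I → ℝ with w_i ≥ 1 for all i. Then for v : I → ℂ the following are equivalent: (i) Σ_i |v_i a_i| < ∞ for every a ∈ Λ_s; (ii) for every B > 0 the series Σ_i e^{-B w_i^{1/s}} |v_i| converges. -/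
variable {I : Type*}

/-- The Roumieu sequence space `Λ_s` over a weight `w : I → ℝ`:
`a ∈ Λ_s` iff there exist `K, B > 0` with `|a i| ≤ K e^{-B w_i^{1/s}}` for all `i`. -/
def RoumieuSeq (s : ℝ) (w : I → ℝ) (a : I → ℂ) : Prop :=
  ∃ K > (0 : ℝ), ∃ B > (0 : ℝ), ∀ i, ‖a i‖ ≤ K * Real.exp (-B * w i ^ (1 / s))

/-- The Beurling sequence space `Λ_(s)` over a weight `w : I → ℝ`:
`a ∈ Λ_(s)` iff for every `B > 0` there is `K_B > 0` with `|a i| ≤ K_B e^{-B w_i^{1/s}}`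
for all `i`. -/
def BeurlingSeq (s : ℝ) (w : I → ℝ) (a : I → ℂ) : Prop :=
  ∀ B > (0 : ℝ), ∃ K > (0 : ℝ), ∀ i, ‖a i‖ ≤ K * Real.exp (-B * w i ^ (1 / s))

/-- The α-dual of a set `S` of sequences: all `v` with `Σ_i |v_i a_i| < ∞` for all `a ∈ S`. -/
def AlphaDual (S : Set (I → ℂ)) : Set (I → ℂ) :=
  {v | ∀ a ∈ S, Summable fun i => ‖v i * a i‖}

/-- `Σ_i |v_i a_i| < ∞` for every `a ∈ Λ_s` iff for every `B > 0` the series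
`Σ_i e^{-B w_i^{1/s}} |v_i|` converges. -/
theorem mem_alphaDual_roumieu_iff_summable {I : Type*} [Countable I]
    (s : ℝ) (hs : 0 < s) (w : I → ℝ) (hw : ∀ i, 1 ≤ w i) (v : I → ℂ) :
    (∀ a : I → ℂ, RoumieuSeq s w a → Summable fun i => ‖v i * a i‖)
      ↔ (∀ B > (0 : ℝ), Summable fun i => Real.exp (-B * w i ^ (1 / s)) * ‖v i‖) := by
  constructor
  · intro h B hB
    have ha := h (fun i => (Real.exp (-B * w i ^ (1 / s)) : ℂ)) ⟨1, one_pos, B, hB, fun i => by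
      rw [Complex.norm_real, Real.norm_of_nonneg (Real.exp_pos _).le, one_mul]⟩
    refine ha.congr fun i => ?_
    rw [norm_mul, Complex.norm_real, Real.norm_of_nonneg (Real.exp_pos _).le, mul_comm]
  · rintro h a ⟨K, -, B, hB, ha⟩
    refine ((h B hB).mul_left K).of_nonneg_of_le (fun i => norm_nonneg _) fun i => ?_
    rw [norm_mul, mul_comm, ← mul_assoc]
    exact mul_le_mul_of_nonneg_right (ha i) (norm_nonneg _)
end

section
/- Let I be a countable index set, s > 0, and w : I → ℝ with w_i ≥ 1 for all i. Then for v : I → ℂ the following are equivalent: (i) Σ_i |v_i a_i| < ∞ for every a ∈ Λ_(s); (ii) there exists B > 0 such that the series Σ_i e^{-B w_i^{1/s}} |v_i| converges. -/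
variable {I : Type*}

/-- If `∑ e^{-B x_i} u_i` diverges for every `B > 0`, there are nonnegative coefficients decaying
faster than every `e^{-B x_i}` against which `u` is still not summable. -/
theorem exists_rapidDecay_not_summable {ι : Type*} {x u : ι → ℝ} (hx : ∀ i, 0 ≤ x i)
    (hu : ∀ i, 0 ≤ u i) (hdiv : ∀ B > (0 : ℝ), ¬ Summable fun i => Real.exp (-B * x i) * u i) :
    ∃ c : ι → ℝ, (∀ i, 0 ≤ c i) ∧
      (∀ B > (0 : ℝ), ∃ K > (0 : ℝ), ∀ i, c i ≤ K * Real.exp (-B * x i)) ∧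
      ¬ Summable fun i => u i * c i := by
  classical
  have hlarge : ∀ n : ℕ, ∃ F : Finset ι,
      (n : ℝ) < ∑ i ∈ F, Real.exp (-((n : ℝ) + 1) * x i) * u i := by
    intro n
    by_contra! h
    exact hdiv ((n : ℝ) + 1) (by positivity) (summable_of_sum_le
      (fun i => mul_nonneg (Real.exp_pos _).le (hu i)) h)
  choose F hF using hlarge
  let c : ι → ℝ := fun i =>
    if h : ∃ n, i ∈ F n then Real.exp (-((Nat.find h : ℝ) + 1) * x i) else 0
  have hc0 : ∀ i, 0 ≤ c i := by
    intro i
    dsimp only [c]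
    split_ifs <;> positivity
  refine ⟨c, hc0, ?_, ?_⟩
  · intro B hB
    obtain ⟨N, hN⟩ := exists_nat_ge B
    let G := (Finset.range N).biUnion F
    have hG : 0 ≤ ∑ i ∈ G, Real.exp (B * x i) := Finset.sum_nonneg fun i _ => (Real.exp_pos _).le
    refine ⟨1 + ∑ i ∈ G, Real.exp (B * x i), by linarith, fun i => ?_⟩
    have hpos := Real.exp_pos (-B * x i)
    dsimp only [c]
    split_ifs with h
    · by_cases hlt : Nat.find h < N
      · have hi : i ∈ G :=
          Finset.mem_biUnion.2 ⟨_, Finset.mem_range.2 hlt, Nat.find_spec h⟩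
        have hle : Real.exp (B * x i) ≤ ∑ i ∈ G, Real.exp (B * x i) :=
          Finset.single_le_sum (f := fun i => Real.exp (B * x i))
            (fun i _ => (Real.exp_pos _).le) hi
        have hone : Real.exp (B * x i) * Real.exp (-B * x i) = 1 := by
          rw [← Real.exp_add]
          simp
        have hexp : Real.exp (-((Nat.find h : ℝ) + 1) * x i) ≤ 1 := by
          rw [Real.exp_le_one_iff, neg_mul, neg_nonpos]
          exact mul_nonneg (by positivity) (hx i)
        nlinarith
      · have hBn : B ≤ (Nat.find h : ℝ) + 1 := by
          have : (N : ℝ) ≤ Nat.find h := by exact_mod_cast not_lt.1 hlt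
          linarith
        have hexp : Real.exp (-((Nat.find h : ℝ) + 1) * x i) ≤ Real.exp (-B * x i) :=
          Real.exp_le_exp.2 (mul_le_mul_of_nonneg_right (neg_le_neg hBn) (hx i))
        nlinarith [mul_nonneg hG hpos.le]
    · positivity
  · intro hs
    obtain ⟨n, hn⟩ := exists_nat_ge (∑' i, u i * c i)
    have hle : ∑ i ∈ F n, Real.exp (-((n : ℝ) + 1) * x i) * u i ≤ ∑ i ∈ F n, u i * c i := by
      refine Finset.sum_le_sum fun i hi => ?_
      have h : ∃ m, i ∈ F m := ⟨n, hi⟩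
      have hmin : (Nat.find h : ℝ) ≤ n := by exact_mod_cast Nat.find_min' h hi
      rw [mul_comm]
      refine mul_le_mul_of_nonneg_left ?_ (hu i)
      simp only [c, dif_pos h]
      exact Real.exp_le_exp.2 (mul_le_mul_of_nonneg_right (by linarith) (hx i))
    have := hs.sum_le_tsum (F n) fun i _ => mul_nonneg (hu i) (hc0 i)
    linarith [hF n]

/-- `Σ_i |v_i a_i| < ∞` for every `a ∈ Λ_(s)` iff there exists `B > 0` such that the
series `Σ_i e^{-B w_i^{1/s}} |v_i|` converges. -/
theorem mem_alphaDual_beurling_iff_summable {I : Type*} [Countable I]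
    (s : ℝ) (hs : 0 < s) (w : I → ℝ) (hw : ∀ i, 1 ≤ w i) (v : I → ℂ) :
    (∀ a : I → ℂ, BeurlingSeq s w a → Summable fun i => ‖v i * a i‖)
      ↔ (∃ B > (0 : ℝ), Summable fun i => Real.exp (-B * w i ^ (1 / s)) * ‖v i‖) := by
  constructor
  · intro h
    by_contra! hdiv
    obtain ⟨c, hc0, hc, hnot⟩ := exists_rapidDecay_not_summable
      (fun i => Real.rpow_nonneg (zero_le_one.trans (hw i)) (1 / s))
      (fun i => norm_nonneg (v i)) hdiv
    have hnorm : ∀ i, ‖(c i : ℂ)‖ = c i := fun i => Complex.norm_of_nonneg (hc0 i)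
    refine hnot ?_
    have hsum := h (fun i => (c i : ℂ)) fun B hB => by simpa only [hnorm] using hc B hB
    simpa only [norm_mul, hnorm] using hsum
  · rintro ⟨B, hB, hsum⟩ a ha
    obtain ⟨K, -, hK⟩ := ha B hB
    refine Summable.of_nonneg_of_le (fun i => norm_nonneg _) (fun i => ?_) (hsum.mul_left K)
    rw [norm_mul, mul_comm, ← mul_assoc]
    exact mul_le_mul_of_nonneg_right (hK i) (norm_nonneg _)
end

section
/- Let I be a countable index set, s > 0, and w : I → ℝ with w_i ≥ 1 for all i, and assume that for every ε > 0 the series Σ_i e^{-ε w_i^{1/s}} converges. Then for v : I → ℂ the following are equivalent: (i) v belongs to the α-dual of Λ_s, i.e. Σ_i |v_i a_i| < ∞ for every a ∈ Λ_s; (ii) for every B > 0 there exists K_B > 0 such that |v_i| ≤ K_B e^{B w_i^{1/s}} for all i ∈ I. -/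
variable {I : Type*}

/-- Characterisation of the α-dual of the Roumieu space `Λ_s`: assuming
`Σ_i e^{-ε w_i^{1/s}} < ∞` for every `ε > 0`, a sequence `v` belongs to `(Λ_s)^α` iff
for every `B > 0` there is `K_B > 0` with `|v_i| ≤ K_B e^{B w_i^{1/s}}` for all `i`. -/
theorem mem_alphaDual_roumieu_iff_bound {I : Type*} [Countable I]
    (s : ℝ) (hs : 0 < s) (w : I → ℝ) (hw : ∀ i, 1 ≤ w i)
    (hsum : ∀ ε > (0 : ℝ), Summable fun i => Real.exp (-ε * w i ^ (1 / s)))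
    (v : I → ℂ) :
    v ∈ AlphaDual {a | RoumieuSeq s w a}
      ↔ (∀ B > (0 : ℝ), ∃ K > (0 : ℝ), ∀ i, ‖v i‖ ≤ K * Real.exp (B * w i ^ (1 / s))) := by
  constructor
  · intro hv B hB
    have h := hv (fun i => (Real.exp (-B * w i ^ (1 / s)) : ℂ))
      ⟨1, one_pos, B, hB, fun i => by
        rw [one_mul, Complex.norm_real, Real.norm_eq_abs, Real.abs_exp]⟩
    refine ⟨(∑' i, ‖v i * (Real.exp (-B * w i ^ (1 / s)) : ℂ)‖) + 1,
      add_pos_of_nonneg_of_pos (tsum_nonneg fun _ => norm_nonneg _) one_pos, fun i => ?_⟩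
    have hi := h.le_tsum i fun _ _ => norm_nonneg _
    rw [norm_mul, Complex.norm_real, Real.norm_eq_abs, Real.abs_exp, neg_mul, Real.exp_neg,
      ← div_eq_mul_inv, div_le_iff₀ (Real.exp_pos _)] at hi
    refine hi.trans (mul_le_mul_of_nonneg_right ?_ (Real.exp_pos _).le)
    simp only [neg_mul]
    exact (lt_add_one _).le
  · rintro hv a ⟨K, hK, B, hB, ha⟩
    obtain ⟨L, hL, hv⟩ := hv (B / 2) (half_pos hB)
    refine ((hsum (B / 2) (half_pos hB)).mul_left (L * K)).of_nonneg_of_le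
      (fun _ => norm_nonneg _) fun i => ?_
    calc ‖v i * a i‖ = ‖v i‖ * ‖a i‖ := norm_mul _ _
      _ ≤ (L * Real.exp (B / 2 * w i ^ (1 / s))) * (K * Real.exp (-B * w i ^ (1 / s))) :=
        mul_le_mul (hv i) (ha i) (norm_nonneg _) (by positivity)
      _ = L * K * Real.exp (-(B / 2) * w i ^ (1 / s)) := by
        rw [mul_mul_mul_comm, ← Real.exp_add]
        ring_nf
end

section
/- Let I be a countable index set, s > 0, and w : I → ℝ with w_i ≥ 1 for all i, and assume that for every ε > 0 the series Σ_i e^{-ε w_i^{1/s}} converges. Then for v : I → ℂ the following are equivalent: (i) v belongs to the α-dual of Λ_(s), i.e. Σ_i |v_i a_i| < ∞ for every a ∈ Λ_(s); (ii) there exist B > 0 and K > 0 such that |v_i| ≤ K e^{B w_i^{1/s}} for all i ∈ I. -/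
variable {I : Type*}

/-- If `v` multiplies every sequence decaying faster than all exponentials `e^{-B m_i}` into an
absolutely summable one, then `v` is dominated by a single exponential `K e^{B m_i}`. -/
theorem exists_bound_of_forall_summable_mul {I : Type*} {m : I → ℝ} (hm : ∀ i, 0 ≤ m i) {v : I → ℂ}
    (hv : ∀ a : I → ℂ, (∀ B > (0 : ℝ), ∃ K > (0 : ℝ), ∀ i, ‖a i‖ ≤ K * Real.exp (-B * m i)) →
      Summable fun i => ‖v i * a i‖) :
    ∃ B > (0 : ℝ), ∃ K > (0 : ℝ), ∀ i, ‖v i‖ ≤ K * Real.exp (B * m i) := by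
  classical
  by_contra! hcon
  have hex (n : ℕ) : ∃ i, ((n : ℝ) + 1) * Real.exp (((n : ℝ) + 1) * m i) < ‖v i‖ :=
    hcon _ (by positivity) _ (by positivity)
  choose j hj using hex
  have hexp (n : ℕ) : Real.exp (((n : ℝ) + 1) * m (j n)) ≤ ‖v (j n)‖ :=
    (le_mul_of_one_le_left (Real.exp_pos _).le (by simp)).trans (hj n).le
  have hlarge (n : ℕ) : (n : ℝ) < ‖v (j n)‖ := by
    have h1 : 1 ≤ Real.exp (((n : ℝ) + 1) * m (j n)) :=
      Real.one_le_exp (mul_nonneg (by positivity) (hm _))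
    nlinarith [hj n]
  have hinf : (Set.range j).Infinite := by
    intro hfin
    obtain ⟨C, hC⟩ := (hfin.image fun i => ‖v i‖).bddAbove
    obtain ⟨n, hn⟩ := exists_nat_gt C
    exact (hn.trans (hlarge n)).not_ge (hC ⟨_, ⟨n, rfl⟩, rfl⟩)
  let a : I → ℂ := (Set.range j).indicator fun i => (v i)⁻¹
  have ha : ∀ B > (0 : ℝ), ∃ K > (0 : ℝ), ∀ i, ‖a i‖ ≤ K * Real.exp (-B * m i) := by
    intro B _
    obtain ⟨N, hN⟩ := exists_nat_gt B
    have hnonneg (n : ℕ) : 0 ≤ ‖a (j n)‖ * Real.exp (B * m (j n)) := by positivity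
    have hsum_nonneg := Finset.sum_nonneg fun n (_ : n ∈ Finset.range N) => hnonneg n
    refine ⟨1 + ∑ n ∈ Finset.range N, ‖a (j n)‖ * Real.exp (B * m (j n)), by positivity, ?_⟩
    intro i
    rw [neg_mul, Real.exp_neg, ← div_eq_mul_inv, le_div_iff₀ (Real.exp_pos _)]
    by_cases hi : i ∈ Set.range j
    · obtain ⟨n, rfl⟩ := hi
      by_cases hn : n < N
      · have := Finset.single_le_sum (fun n _ => hnonneg n) (Finset.mem_range.2 hn)
        linarith
      · have hBn : B ≤ (n : ℝ) + 1 := by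
          have : (N : ℝ) ≤ n := by exact_mod_cast not_lt.1 hn
          linarith
        have hle : Real.exp (B * m (j n)) ≤ ‖v (j n)‖ :=
          (Real.exp_le_exp.2 (mul_le_mul_of_nonneg_right hBn (hm _))).trans (hexp n)
        have hone : ‖a (j n)‖ * Real.exp (B * m (j n)) ≤ 1 := by
          simp only [a, Set.indicator_of_mem (Set.mem_range_self n), norm_inv]
          exact inv_mul_le_one_of_le₀ hle (norm_nonneg _)
        linarith
    · simp only [a, Set.indicator_of_notMem hi, norm_zero, zero_mul]
      positivity
  have hev := (hv a ha).tendsto_cofinite_zero.eventually (gt_mem_nhds one_pos)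
  refine hinf ((Filter.eventually_cofinite.1 hev).subset ?_)
  rintro _ ⟨n, rfl⟩
  have hne : v (j n) ≠ 0 := norm_pos_iff.1 ((Nat.cast_nonneg n).trans_lt (hlarge n))
  simp [a, hne]

/-- Characterisation of the α-dual of the Beurling space `Λ_(s)`: assuming
`Σ_i e^{-ε w_i^{1/s}} < ∞` for every `ε > 0`, a sequence `v` belongs to `(Λ_(s))^α` iff
there exist `B > 0` and `K > 0` with `|v_i| ≤ K e^{B w_i^{1/s}}` for all `i`. -/
theorem mem_alphaDual_beurling_iff_bound {I : Type*} [Countable I]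
    (s : ℝ) (hs : 0 < s) (w : I → ℝ) (hw : ∀ i, 1 ≤ w i)
    (hsum : ∀ ε > (0 : ℝ), Summable fun i => Real.exp (-ε * w i ^ (1 / s)))
    (v : I → ℂ) :
    v ∈ AlphaDual {a | BeurlingSeq s w a}
      ↔ (∃ B > (0 : ℝ), ∃ K > (0 : ℝ), ∀ i, ‖v i‖ ≤ K * Real.exp (B * w i ^ (1 / s))) := by
  constructor
  · intro hv
    exact exists_bound_of_forall_summable_mul
      (fun i => Real.rpow_nonneg (zero_le_one.trans (hw i)) _) hv
  · rintro ⟨B, hB, K, hK, hv⟩ a ha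
    obtain ⟨K', -, ha⟩ := ha (B + 1) (by positivity)
    refine Summable.of_nonneg_of_le (fun i => norm_nonneg _) (fun i => ?_)
      ((hsum 1 one_pos).mul_left (K * K'))
    calc ‖v i * a i‖ = ‖v i‖ * ‖a i‖ := norm_mul _ _
      _ ≤ (K * Real.exp (B * w i ^ (1 / s))) * (K' * Real.exp (-(B + 1) * w i ^ (1 / s))) :=
        mul_le_mul (hv i) (ha i) (norm_nonneg _) (by positivity)
      _ = K * K' * Real.exp (-1 * w i ^ (1 / s)) := by
        rw [mul_mul_mul_comm, ← Real.exp_add]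
        ring_nf
end

section
/- Let I be a countable index set, s > 0, and w : I → ℝ with w_i ≥ 1 for all i, and assume that for every ε > 0 the series Σ_i e^{-ε w_i^{1/s}} converges. Then for u : I → ℂ the following are equivalent: (i) u belongs to the α-dual of the α-dual of Λ_s, i.e. Σ_i |u_i v_i| < ∞ for every v in (Λ_s)^α; (ii) there exists B > 0 such that the series Σ_i e^{B w_i^{1/s}} |u_i| converges. -/
variable {I : Type*}

open Filter in
/-- A sequence in the second α-dual of `Λ_s` belongs to `Λ_s`. -/
theorem roumieuSeq_of_mem_alphaDual_alphaDual {I : Type*} {s : ℝ} {w : I → ℝ}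
    (hw : ∀ i, 0 ≤ w i)
    (hsum : ∀ ε > (0 : ℝ), Summable fun i => Real.exp (-ε * w i ^ (1 / s)))
    {u : I → ℂ} (hu : u ∈ AlphaDual (AlphaDual {a | RoumieuSeq s w a})) :
    RoumieuSeq s w u := by
  classical
  by_contra hnot
  have hW : ∀ i, 0 ≤ w i ^ (1 / s) := fun i => Real.rpow_nonneg (hw i) _
  have key : ∀ n : ℕ, ∃ i,
      ((n : ℝ) + 1) * Real.exp (-(1 / ((n : ℝ) + 1)) * w i ^ (1 / s)) < ‖u i‖ := by
    intro n
    by_contra! h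
    exact hnot ⟨(n : ℝ) + 1, by positivity, 1 / ((n : ℝ) + 1), by positivity, h⟩
  choose f hf using key
  have hpos : ∀ n, 0 < ‖u (f n)‖ := fun n => lt_trans (by positivity) (hf n)
  let v : I → ℂ := fun i => if i ∈ Set.range f then (u i)⁻¹ else 0
  have hv : v ∈ AlphaDual {a | RoumieuSeq s w a} := by
    rintro a ⟨K, hK, B, hB, ha⟩
    obtain ⟨N, hN⟩ := exists_nat_gt (2 / B)
    refine Summable.of_norm_bounded_eventually ((hsum (B / 2) (by positivity)).mul_left K) ?_
    have hfin : (f '' Set.Iio N).Finite := (Set.finite_Iio N).image f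
    filter_upwards [hfin.compl_mem_cofinite] with i hi
    by_cases hir : i ∈ Set.range f
    · obtain ⟨n, rfl⟩ := hir
      have hn : N ≤ n := by
        by_contra! h
        exact hi ⟨n, h, rfl⟩
      have hn1 : 2 / B ≤ (n : ℝ) + 1 := by
        have : (N : ℝ) ≤ n := by exact_mod_cast hn
        linarith
      have hB2 : 1 / ((n : ℝ) + 1) ≤ B / 2 := by
        rw [div_le_iff₀ hB] at hn1
        rw [div_le_div_iff₀ (by positivity) (by norm_num)]
        linarith
      have hlow : Real.exp (-(B / 2) * w (f n) ^ (1 / s)) ≤ ‖u (f n)‖ := by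
        refine le_trans ?_ (hf n).le
        calc Real.exp (-(B / 2) * w (f n) ^ (1 / s))
            ≤ Real.exp (-(1 / ((n : ℝ) + 1)) * w (f n) ^ (1 / s)) := by
              have := hW (f n)
              gcongr
          _ ≤ _ := le_mul_of_one_le_left (Real.exp_pos _).le (by simp)
      have hval : v (f n) = (u (f n))⁻¹ := if_pos ⟨n, rfl⟩
      rw [norm_norm, norm_mul, hval, norm_inv, inv_mul_le_iff₀ (hpos n)]
      calc ‖a (f n)‖ ≤ K * Real.exp (-B * w (f n) ^ (1 / s)) := ha _
        _ = Real.exp (-(B / 2) * w (f n) ^ (1 / s))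
              * (K * Real.exp (-(B / 2) * w (f n) ^ (1 / s))) := by
            rw [mul_left_comm, ← Real.exp_add]
            ring_nf
        _ ≤ _ := by gcongr
    · have hval : v i = 0 := if_neg hir
      rw [hval, zero_mul, norm_zero, norm_zero]
      positivity
  have hrange : (Set.range f).Finite := by
    have h1 : ∀ᶠ i in cofinite, ‖u i * v i‖ < 1 :=
      (hu v hv).tendsto_cofinite_zero.eventually_lt_const one_pos
    refine (eventually_cofinite.mp h1).subset ?_
    rintro _ ⟨n, rfl⟩
    have hval : v (f n) = (u (f n))⁻¹ := if_pos ⟨n, rfl⟩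
    simp [hval, norm_pos_iff.mp (hpos n)]
  obtain ⟨C, hC⟩ := (hrange.image fun i => ‖u i‖ * Real.exp (w i ^ (1 / s))).bddAbove
  obtain ⟨n, hn⟩ := exists_nat_gt C
  have hle : ‖u (f n)‖ * Real.exp (w (f n) ^ (1 / s)) ≤ C := hC ⟨f n, ⟨n, rfl⟩, rfl⟩
  have hexp : Real.exp (-(w (f n) ^ (1 / s)))
      ≤ Real.exp (-(1 / ((n : ℝ) + 1)) * w (f n) ^ (1 / s)) := by
    have h1 : 1 / ((n : ℝ) + 1) ≤ 1 := by
      rw [div_le_one (by positivity)]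
      simp
    rw [Real.exp_le_exp]
    nlinarith [hW (f n)]
  have hgt : (n : ℝ) + 1 ≤ ‖u (f n)‖ * Real.exp (w (f n) ^ (1 / s)) := by
    rw [← div_le_iff₀ (Real.exp_pos _), div_eq_mul_inv, ← Real.exp_neg]
    exact le_trans (by gcongr) (hf n).le
  linarith

/-- Characterisation of the second α-dual of the Roumieu space `Λ_s`: assuming
`Σ_i e^{-ε w_i^{1/s}} < ∞` for every `ε > 0`, a sequence `u` belongs to `((Λ_s)^α)^α` iff
there exists `B > 0` such that `Σ_i e^{B w_i^{1/s}} |u_i|` converges. -/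
theorem mem_alphaDual_alphaDual_roumieu_iff {I : Type*} [Countable I]
    (s : ℝ) (hs : 0 < s) (w : I → ℝ) (hw : ∀ i, 1 ≤ w i)
    (hsum : ∀ ε > (0 : ℝ), Summable fun i => Real.exp (-ε * w i ^ (1 / s)))
    (u : I → ℂ) :
    u ∈ AlphaDual (AlphaDual {a | RoumieuSeq s w a})
      ↔ (∃ B > (0 : ℝ), Summable fun i => Real.exp (B * w i ^ (1 / s)) * ‖u i‖) := by
  constructor
  · intro hu
    obtain ⟨K, hK, B, hB, h⟩ :=
      roumieuSeq_of_mem_alphaDual_alphaDual (fun i => zero_le_one.trans (hw i)) hsum hu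
    refine ⟨B / 2, by positivity, Summable.of_nonneg_of_le (fun i => by positivity) (fun i => ?_)
      ((hsum (B / 2) (by positivity)).mul_left K)⟩
    calc Real.exp (B / 2 * w i ^ (1 / s)) * ‖u i‖
        ≤ Real.exp (B / 2 * w i ^ (1 / s)) * (K * Real.exp (-B * w i ^ (1 / s))) := by
          gcongr
          exact h i
      _ = K * Real.exp (-(B / 2) * w i ^ (1 / s)) := by
          rw [mul_left_comm, ← Real.exp_add]
          ring_nf
  · rintro ⟨B, hB, h⟩ v hv
    have hu : RoumieuSeq s w u := by
      refine ⟨(∑' i, Real.exp (B * w i ^ (1 / s)) * ‖u i‖) + 1, ?_, B, hB, fun i => ?_⟩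
      · have : 0 ≤ ∑' i, Real.exp (B * w i ^ (1 / s)) * ‖u i‖ :=
          tsum_nonneg fun i => by positivity
        linarith
      · have hi := h.le_tsum i fun j _ => by positivity
        rw [neg_mul, Real.exp_neg, ← div_eq_mul_inv, le_div_iff₀ (Real.exp_pos _), mul_comm]
        linarith
    simpa only [mul_comm] using hv u hu
end

section
/- Let I be a countable index set, s > 0, and w : I → ℝ with w_i ≥ 1 for all i, and assume that for every ε > 0 the series Σ_i e^{-ε w_i^{1/s}} converges. Then for u : I → ℂ the following are equivalent: (i) u belongs to the α-dual of the α-dual of Λ_(s), i.e. Σ_i |u_i v_i| < ∞ for every v in (Λ_(s))^α; (ii) for every B > 0 the series Σ_i e^{B w_i^{1/s}} |u_i| converges. -/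
variable {I : Type*}

/-- A sequence in the α-dual of the Beurling space grows at most like `n e^{n w_i^{1/s}}`. -/
theorem exists_norm_le_of_mem_alphaDual_beurlingSeq {I : Type*} {s : ℝ} {w : I → ℝ}
    (hw : ∀ i, 0 ≤ w i) {v : I → ℂ} (hv : v ∈ AlphaDual {a | BeurlingSeq s w a}) :
    ∃ n : ℕ, ∀ i, ‖v i‖ ≤ (n + 1) * Real.exp ((n + 1) * w i ^ (1 / s)) := by
  classical
  by_contra! h
  choose f hf using h
  have hx : ∀ i, 0 ≤ w i ^ (1 / s) := fun i => Real.rpow_nonneg (hw i) _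
  have hf_pos : ∀ n, 0 < ‖v (f n)‖ := fun n => lt_trans (by positivity) (hf n)
  set a : I → ℂ := fun i => if i ∈ Set.range f then (v i)⁻¹ else 0 with ha
  have haf : ∀ n, a (f n) = (v (f n))⁻¹ := fun n => by simp [ha]
  have ha_mem : BeurlingSeq s w a := by
    intro B hB
    obtain ⟨N, hN⟩ := exists_nat_ge B
    have hterm : ∀ n, 0 ≤ ‖a (f n)‖ * Real.exp (B * w (f n) ^ (1 / s)) := fun n => by positivity
    have hsum_nonneg := Finset.sum_nonneg fun n (_ : n ∈ Finset.range N) => hterm n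
    refine ⟨1 + ∑ n ∈ Finset.range N, ‖a (f n)‖ * Real.exp (B * w (f n) ^ (1 / s)),
      by linarith, fun i => ?_⟩
    by_cases hi : i ∈ Set.range f
    · obtain ⟨n, rfl⟩ := hi
      rw [neg_mul, Real.exp_neg, ← div_eq_mul_inv, le_div_iff₀ (Real.exp_pos _)]
      by_cases hn : n < N
      · have := Finset.single_le_sum (fun n _ => hterm n) (Finset.mem_range.2 hn)
        linarith
      · have hBn : B ≤ n + 1 := by
          have : (N : ℝ) ≤ n := by exact_mod_cast not_lt.1 hn
          linarith
        have hexp : Real.exp (B * w (f n) ^ (1 / s)) ≤ ‖v (f n)‖ :=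
          calc Real.exp (B * w (f n) ^ (1 / s))
              ≤ Real.exp ((n + 1) * w (f n) ^ (1 / s)) :=
                Real.exp_le_exp.2 (mul_le_mul_of_nonneg_right hBn (hx _))
            _ ≤ (n + 1) * Real.exp ((n + 1) * w (f n) ^ (1 / s)) :=
                le_mul_of_one_le_left (Real.exp_pos _).le (by simp)
            _ ≤ ‖v (f n)‖ := (hf n).le
        have : ‖a (f n)‖ * Real.exp (B * w (f n) ^ (1 / s)) ≤ 1 := by
          rw [haf, norm_inv, inv_mul_le_iff₀ (hf_pos n), mul_one]
          exact hexp
        linarith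
    · have : a i = 0 := if_neg hi
      rw [this, norm_zero]
      positivity
  have hfin : (Set.range f).Finite := by
    have hlt := (hv a ha_mem).tendsto_cofinite_zero.eventually_lt_const zero_lt_one
    refine (Filter.eventually_cofinite.1 hlt).subset ?_
    rintro _ ⟨n, rfl⟩
    simp [haf, mul_inv_cancel₀ (hf_pos n).ne']
  obtain ⟨C, hC⟩ := (hfin.image fun i => ‖v i‖).bddAbove
  obtain ⟨n, hn⟩ := exists_nat_ge C
  have hle : ‖v (f n)‖ ≤ C := hC ⟨f n, ⟨n, rfl⟩, rfl⟩
  have hexp : 1 ≤ Real.exp ((n + 1) * w (f n) ^ (1 / s)) :=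
    Real.one_le_exp (mul_nonneg (by positivity) (hx _))
  have hgrow : (n + 1 : ℝ) ≤ (n + 1) * Real.exp ((n + 1) * w (f n) ^ (1 / s)) :=
    le_mul_of_one_le_right (by positivity) hexp
  linarith [hf n]

/-- Under the summability hypothesis, `e^{B w_i^{1/s}}` lies in the α-dual of the Beurling
space. -/
theorem exp_mem_alphaDual_beurlingSeq {I : Type*} {s : ℝ} {w : I → ℝ}
    (hsum : Summable fun i => Real.exp (-1 * w i ^ (1 / s))) {B : ℝ} (hB : 0 < B) :
    (fun i => (Real.exp (B * w i ^ (1 / s)) : ℂ)) ∈ AlphaDual {a | BeurlingSeq s w a} := by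
  intro a ha
  obtain ⟨K, -, haK⟩ := ha (B + 1) (by linarith)
  refine (hsum.mul_left K).of_nonneg_of_le (fun _ => norm_nonneg _) fun i => ?_
  rw [norm_mul, Complex.norm_real, Real.norm_of_nonneg (Real.exp_pos _).le]
  calc Real.exp (B * w i ^ (1 / s)) * ‖a i‖
      ≤ Real.exp (B * w i ^ (1 / s)) * (K * Real.exp (-(B + 1) * w i ^ (1 / s))) :=
        mul_le_mul_of_nonneg_left (haK i) (Real.exp_pos _).le
    _ = K * Real.exp (-1 * w i ^ (1 / s)) := by
        rw [mul_left_comm, ← Real.exp_add]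
        ring_nf

/-- Characterisation of the second α-dual of the Beurling space `Λ_(s)`: assuming
`Σ_i e^{-ε w_i^{1/s}} < ∞` for every `ε > 0`, a sequence `u` belongs to `((Λ_(s))^α)^α` iff
for every `B > 0` the series `Σ_i e^{B w_i^{1/s}} |u_i|` converges. -/
theorem mem_alphaDual_alphaDual_beurling_iff {I : Type*} [Countable I]
    (s : ℝ) (hs : 0 < s) (w : I → ℝ) (hw : ∀ i, 1 ≤ w i)
    (hsum : ∀ ε > (0 : ℝ), Summable fun i => Real.exp (-ε * w i ^ (1 / s)))
    (u : I → ℂ) :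
    u ∈ AlphaDual (AlphaDual {a | BeurlingSeq s w a})
      ↔ (∀ B > (0 : ℝ), Summable fun i => Real.exp (B * w i ^ (1 / s)) * ‖u i‖) := by
  constructor
  · intro hu B hB
    refine (hu _ (exp_mem_alphaDual_beurlingSeq (hsum 1 one_pos) hB)).congr fun i => ?_
    rw [norm_mul, Complex.norm_real, Real.norm_of_nonneg (Real.exp_pos _).le, mul_comm]
  · intro hu v hv
    obtain ⟨n, hn⟩ := exists_norm_le_of_mem_alphaDual_beurlingSeq
      (fun i => zero_le_one.trans (hw i)) hv
    refine ((hu (n + 1) (by positivity)).mul_left (n + 1 : ℝ)).of_nonneg_of_le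
      (fun _ => norm_nonneg _) fun i => ?_
    rw [norm_mul, mul_comm, ← mul_assoc]
    exact mul_le_mul_of_nonneg_right (hn i) (norm_nonneg _)
end

section
/- Let I be a countable index set, s > 0, and w : I → ℝ with w_i ≥ 1 for all i, and assume that for every ε > 0 the series Σ_i e^{-ε w_i^{1/s}} converges. Then the Roumieu sequence space Λ_s is perfect: ((Λ_s)^α)^α = Λ_s, i.e. a function u : I → ℂ satisfies Σ_i |u_i v_i| < ∞ for every v ∈ (Λ_s)^α if and only if u ∈ Λ_s. -/
variable {I : Type*}

/-- A sequence supported on the range of `f : ℕ → I`, taking there a value `exp (m i / (n + 1))`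
for some `n` with `f n = i`, is in the α-dual of the sequences decaying like `exp (-B * m i)`. -/
theorem summable_norm_mul_of_sparse_exp {I : Type*} {m : I → ℝ} (hm : ∀ i, 0 ≤ m i)
    (hsum : ∀ ε > (0 : ℝ), Summable fun i => Real.exp (-ε * m i))
    {f : ℕ → I} {N : I → ℕ} (hN : ∀ i ∈ Set.range f, f (N i) = i) {v : I → ℂ}
    (hv : ∀ i ∈ Set.range f, ‖v i‖ = Real.exp (m i / (N i + 1)))
    (hv0 : ∀ i ∉ Set.range f, v i = 0) {a : I → ℂ} {K B : ℝ} (hK : 0 < K) (hB : 0 < B)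
    (ha : ∀ i, ‖a i‖ ≤ K * Real.exp (-B * m i)) :
    Summable fun i => ‖v i * a i‖ := by
  obtain ⟨k, hk⟩ := exists_nat_one_div_lt (half_pos hB)
  refine Summable.of_norm_bounded_eventually ((hsum (B / 2) (half_pos hB)).mul_left K) ?_
  refine Set.Finite.subset ((Set.finite_Iic k).image f) ?_
  intro i hi
  by_contra hik
  refine hi ?_
  rw [Set.mem_ofPred_eq, norm_norm, norm_mul]
  by_cases hir : i ∈ Set.range f
  · have hlt : k < N i := by
      by_contra! hle
      exact hik ⟨N i, hle, hN i hir⟩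
    have hdiv : m i / (N i + 1) ≤ B / 2 * m i := by
      have h1 : (1 : ℝ) / (N i + 1) ≤ 1 / (k + 1) := by gcongr
      calc m i / (N i + 1) = 1 / (N i + 1) * m i := by ring
        _ ≤ B / 2 * m i := mul_le_mul_of_nonneg_right (h1.trans hk.le) (hm i)
    calc ‖v i‖ * ‖a i‖ ≤ Real.exp (B / 2 * m i) * (K * Real.exp (-B * m i)) := by
          rw [hv i hir]
          exact mul_le_mul (Real.exp_le_exp.2 hdiv) (ha i) (norm_nonneg _) (Real.exp_nonneg _)
      _ = K * Real.exp (-(B / 2) * m i) := by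
          rw [mul_left_comm, ← Real.exp_add]
          ring_nf
  · rw [hv0 i hir, norm_zero, zero_mul]
    positivity

/-- The Roumieu sequence space `Λ_s` is perfect: assuming
`Σ_i e^{-ε w_i^{1/s}} < ∞` for every `ε > 0`, one has `((Λ_s)^α)^α = Λ_s`. -/
theorem roumieu_perfect {I : Type*} [Countable I]
    (s : ℝ) (hs : 0 < s) (w : I → ℝ) (hw : ∀ i, 1 ≤ w i)
    (hsum : ∀ ε > (0 : ℝ), Summable fun i => Real.exp (-ε * w i ^ (1 / s))) :
    AlphaDual (AlphaDual {a : I → ℂ | RoumieuSeq s w a}) = {a : I → ℂ | RoumieuSeq s w a} := by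
  classical
  have hm : ∀ i, 0 ≤ w i ^ (1 / s) := fun i => Real.rpow_nonneg (zero_le_one.trans (hw i)) _
  refine Set.Subset.antisymm (fun u hu => ?_) fun a ha v hv => by
    simpa only [mul_comm] using hv a ha
  by_contra hnot
  have hbig : ∀ n : ℕ, ∃ i,
      ((n : ℝ) + 1) * Real.exp (-(1 / ((n : ℝ) + 1)) * w i ^ (1 / s)) < ‖u i‖ := by
    intro n
    by_contra! hle
    exact hnot ⟨n + 1, by positivity, 1 / ((n : ℝ) + 1), by positivity, hle⟩
  choose f hf using hbig
  have hpre : ∀ i, ∃ n, i ∈ Set.range f → f n = i := fun i => by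
    by_cases hi : i ∈ Set.range f
    · obtain ⟨n, hn⟩ := hi
      exact ⟨n, fun _ => hn⟩
    · exact ⟨0, fun h => absurd h hi⟩
  choose N hN using hpre
  let v : I → ℂ := fun i =>
    if i ∈ Set.range f then (Real.exp (w i ^ (1 / s) / (N i + 1)) : ℂ) else 0
  have hv : ∀ i ∈ Set.range f, ‖v i‖ = Real.exp (w i ^ (1 / s) / (N i + 1)) := fun i hi => by
    simp only [v, if_pos hi, Complex.norm_real, Real.norm_eq_abs, Real.abs_exp]
  have hv0 : ∀ i ∉ Set.range f, v i = 0 := fun i hi => if_neg hi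
  have hvdual : v ∈ AlphaDual {a : I → ℂ | RoumieuSeq s w a} := by
    rintro a ⟨K, hK, B, hB, ha⟩
    exact summable_norm_mul_of_sparse_exp hm hsum hN hv hv0 hK hB ha
  have hlarge : ∀ i ∈ Set.range f, 1 ≤ ‖u i * v i‖ := fun i hi => by
    have h := hf (N i)
    rw [hN i hi] at h
    rw [norm_mul, hv i hi]
    calc (1 : ℝ) ≤ (N i : ℝ) + 1 := by simp
      _ = ((N i : ℝ) + 1) * Real.exp (-(1 / ((N i : ℝ) + 1)) * w i ^ (1 / s)) *
            Real.exp (w i ^ (1 / s) / (N i + 1)) := by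
          rw [mul_assoc, ← Real.exp_add, neg_mul, one_div_mul_eq_div, neg_add_cancel,
            Real.exp_zero, mul_one]
      _ ≤ _ := by gcongr
  have hfin : (Set.range f).Finite := by
    have hev := (hu v hvdual).tendsto_cofinite_zero.eventually (gt_mem_nhds zero_lt_one)
    exact Set.Finite.subset hev fun i hi => not_lt.2 (hlarge i hi)
  obtain ⟨C, hC⟩ := (hfin.image fun i => ‖u i‖ * Real.exp (w i ^ (1 / s))).bddAbove
  obtain ⟨n, hn⟩ := exists_nat_gt C
  have hbound : ‖u (f n)‖ * Real.exp (w (f n) ^ (1 / s)) ≤ C := hC ⟨f n, ⟨n, rfl⟩, rfl⟩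
  have hexp : Real.exp (-(w (f n) ^ (1 / s))) ≤
      Real.exp (-(1 / ((n : ℝ) + 1)) * w (f n) ^ (1 / s)) := by
    have h1 : 1 / ((n : ℝ) + 1) ≤ 1 := by
      rw [div_le_one (by positivity)]
      simp
    refine Real.exp_le_exp.2 ?_
    nlinarith [hm (f n)]
  have hlower : (n : ℝ) + 1 ≤ ‖u (f n)‖ * Real.exp (w (f n) ^ (1 / s)) := by
    calc (n : ℝ) + 1 = ((n : ℝ) + 1) * Real.exp (-(w (f n) ^ (1 / s))) *
          Real.exp (w (f n) ^ (1 / s)) := by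
          rw [mul_assoc, ← Real.exp_add]
          simp
      _ ≤ _ := by
          gcongr
          exact (mul_le_mul_of_nonneg_left hexp (by positivity)).trans (hf n).le
  linarith
end
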